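/- arXiv:1204.2837 — 2 statements merged into one kernel-verified Lean document; each statement's English description precedes it below -/
import Mathlib

section
/- Let V be a finite type, G a simple graph on V, T a complete linear order, and n : V → T a node-weight function with no isolated regional minima, i.e. every vertex i has a neighbor j with n j ≤ n i. Let e = δ_en n, so e i j = n i ⊔ n j on adjacent pairs. Then the regional minima of n determine exactly the regional minima of e: an adjacent pair {i, j} belongs to a regional minimum of the edge weights e if and only if n i = n j and i belongs to a regional minimum of the node weights n. -/
/-- A vertex `i` belongs to a regional minimum of node weights `n`. -/
def NodeRegMin {V : Type*} {T : Type*} [LinearOrder T] (G : SimpleGraph V)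
    (n : V → T) (i : V) : Prop :=
  ∀ v : V, (∃ p : G.Walk i v, ∀ x ∈ p.support, n x = n i) →
    ∀ w, G.Adj v w → n i ≤ n w

/-- An adjacent pair `{i, j}` belongs to a regional minimum of edge weights `e`. -/
def EdgeRegMin {V : Type*} {T : Type*} [LinearOrder T] (G : SimpleGraph V)
    (e : V → V → T) (i j : V) : Prop :=
  G.Adj i j ∧
    ∀ v : V, (∃ p : G.Walk i v, ∀ d ∈ p.darts, e d.fst d.snd = e i j) →
      ∀ w, G.Adj v w → e i j ≤ e v w

theorem NodeRegMin.le_of_adj {V T : Type*} [LinearOrder T] {G : SimpleGraph V} {n : V → T}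
    {i v : V} (h : NodeRegMin G n i) (hv : G.Adj i v) : n i ≤ n v :=
  h i ⟨.nil, by simp⟩ v hv

theorem NodeRegMin.of_adj {V T : Type*} [LinearOrder T] {G : SimpleGraph V} {n : V → T}
    {i v : V} (h : NodeRegMin G n i) (hv : G.Adj i v) (heq : n v = n i) :
    NodeRegMin G n v := by
  rintro u ⟨p, hp⟩ w hw
  rw [heq] at hp ⊢
  exact h u ⟨.cons hv p, by simpa using hp⟩ w hw

theorem NodeRegMin.eq_of_walk {V T : Type*} [LinearOrder T] {G : SimpleGraph V} {n : V → T}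
    {i v : V} (h : NodeRegMin G n i) (p : G.Walk i v)
    (hp : ∀ d ∈ p.darts, n d.fst ⊔ n d.snd = n i) : n v = n i := by
  induction p with
  | nil => rfl
  | cons ha p ih =>
    simp only [SimpleGraph.Walk.darts_cons, List.mem_cons, forall_eq_or_imp] at hp
    have heq := le_antisymm (sup_eq_left.mp hp.1) (h.le_of_adj ha)
    rw [← heq] at hp ⊢
    exact ih (h.of_adj ha heq) hp.2

theorem sup_eq_of_mem_darts {V T : Type*} [LinearOrder T] {G : SimpleGraph V} {n : V → T}
    {i v : V} {k : T} (p : G.Walk i v) (hp : ∀ x ∈ p.support, n x = k) :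
    ∀ d ∈ p.darts, n d.fst ⊔ n d.snd = k := by
  intro d hd
  rw [hp _ (p.dart_fst_mem_support_of_mem_darts hd),
    hp _ (p.dart_snd_mem_support_of_mem_darts hd), sup_idem]

/-- if `n` has no isolated regional minima and `e = δ_en n`
(`e i j = n i ⊔ n j`), then an adjacent pair `{i, j}` belongs to a regional
minimum of `e` iff `n i = n j` and `i` belongs to a regional minimum of `n`. -/
theorem regional_minima_of_dilated_node_weights {V : Type*} [Fintype V]
    (G : SimpleGraph V) {T : Type*} [CompleteLinearOrder T] (n : V → T)
    (hni : ∀ i : V, ∃ j, G.Adj i j ∧ n j ≤ n i) (i j : V) (hij : G.Adj i j) :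
    EdgeRegMin G (fun a b => n a ⊔ n b) i j ↔ n i = n j ∧ NodeRegMin G n i := by
  constructor
  · rintro ⟨-, h⟩
    have le_of_walk : ∀ v, (∃ p : G.Walk i v, ∀ d ∈ p.darts, n d.fst ⊔ n d.snd = n i ⊔ n j) →
        n i ⊔ n j ≤ n v := by
      intro v hv
      obtain ⟨u, hu, hle⟩ := hni v
      simpa only [sup_eq_left.mpr hle] using h v hv u hu
    have hi : n i ⊔ n j ≤ n i := le_of_walk i ⟨.nil, by simp⟩
    have hj : n i ⊔ n j ≤ n j := le_of_walk j ⟨.cons hij .nil, by simp⟩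
    have heq : n i = n j := le_antisymm (le_sup_left.trans hj) (le_sup_right.trans hi)
    refine ⟨heq, ?_⟩
    rw [← heq, sup_idem] at le_of_walk
    rintro v ⟨p, hp⟩ w hw
    by_contra! hlt
    refine hlt.not_ge (le_of_walk w ⟨p.concat hw, ?_⟩)
    simp only [SimpleGraph.Walk.darts_concat, List.concat_eq_append, List.mem_append,
      List.mem_singleton]
    rintro d (hd | rfl)
    · exact sup_eq_of_mem_darts p hp d hd
    · simp [hp v p.end_mem_support, hlt.le]
  · rintro ⟨heq, h⟩
    refine ⟨hij, ?_⟩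
    simp only [← heq, sup_idem]
    rintro v ⟨p, hp⟩ w -
    exact (h.eq_of_walk p hp).ge.trans le_sup_left
end

section
/- Let V be a finite type, G a simple graph on V, and n : V → ℝ a node-weight function, with node erosion ε n defined by (ε n) i = min(n i, minimum of n j over the neighbors j of i). For every walk x₀, x₁, …, x_p in G, the topographic length equals the final altitude, i.e. n x₀ + ∑_{k=1}^{p} (n x_k − (ε n) x_k) = n x_p, if and only if the walk is a path of steepest descent traversed upward: (ε n) x_k = n x_{k−1} for every 1 ≤ k ≤ p. -/
open Finset

/-- The node erosion: `(nodeErosion G n) i` is the minimum of `n i` and of the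
weights of the neighbors of `i` (equal to `n i` if `i` has no neighbor). -/
noncomputable def nodeErosion {V : Type*} [Fintype V] [DecidableEq V] (G : SimpleGraph V)
    [DecidableRel G.Adj] (n : V → ℝ) (i : V) : ℝ :=
  (insert i (G.neighborFinset i)).inf' (insert_nonempty i _) n

theorem nodeErosion_le_of_adj {V : Type*} [Fintype V] [DecidableEq V] (G : SimpleGraph V)
    [DecidableRel G.Adj] (n : V → ℝ) {i j : V} (h : G.Adj i j) : nodeErosion G n j ≤ n i :=
  inf'_le _ (by simp [h.symm])

/-- The topographic length of a walk is at least its final altitude. -/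
theorem le_topographic_length {V : Type*} [Fintype V] [DecidableEq V] (G : SimpleGraph V)
    [DecidableRel G.Adj] (n : V → ℝ) {u v : V} (p : G.Walk u v) :
    n v ≤ n u + (p.darts.map (fun d => n d.snd - nodeErosion G n d.snd)).sum := by
  induction p with
  | nil => simp
  | cons h p ih =>
    have := nodeErosion_le_of_adj G n h
    simp only [SimpleGraph.Walk.darts_cons, List.map_cons, List.sum_cons]
    linarith

/-- the topographic length of a walk equals its final altitude
iff the walk is a path of steepest descent traversed upward, i.e.
`(ε n) x_k = n x_{k-1}` for every step of the walk. -/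
theorem topographic_length_eq_iff_steepest_descent {V : Type*} [Fintype V] [DecidableEq V]
    (G : SimpleGraph V) [DecidableRel G.Adj] (n : V → ℝ) (u v : V)
    (p : G.Walk u v) :
    n u + (p.darts.map (fun d => n d.snd - nodeErosion G n d.snd)).sum = n v ↔
      ∀ d ∈ p.darts, nodeErosion G n d.snd = n d.fst := by
  induction p with
  | nil => simp
  | cons h p ih =>
    have h₁ := nodeErosion_le_of_adj G n h
    have h₂ := le_topographic_length G n p
    simp only [SimpleGraph.Walk.darts_cons, List.map_cons, List.sum_cons, List.forall_mem_cons]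
    rw [← ih]
    constructor
    · intro heq
      constructor <;> linarith
    · rintro ⟨h₃, h₄⟩
      linarith
end
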